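/- Let X be a completely regular topological space and let A, B ⊆ X be disjoint sets. Then: (a) if A and B are both Lindelöf G_δ-sets, then A and B are 1-separated; (b) if A (with the subspace topology) is a Lindelöf hereditarily Baire space and B is a functionally G_δ-set, then A and B are 1-separated; (c) if A is Lindelöf and B is an F_σ-set, then A and B are 2-separated. -/

import Mathlib

open Set

universe u v

/-- `A` is functionally open in `X`: `A = f⁻¹((0,1])` for some continuous `f : X → [0,1]`. -/
def FunctionallyOpen (X : Type u) [TopologicalSpace X] (A : Set X) : Prop :=
  ∃ f : X → ℝ, Continuous f ∧ (∀ x, f x ∈ Set.Icc (0:ℝ) 1) ∧ A = f ⁻¹' (Set.Ioc 0 1)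

/-- `A` is functionally closed in `X`: `A = f⁻¹(0)` for some continuous `f : X → [0,1]`. -/
def FunctionallyClosed (X : Type u) [TopologicalSpace X] (A : Set X) : Prop :=
  ∃ f : X → ℝ, Continuous f ∧ (∀ x, f x ∈ Set.Icc (0:ℝ) 1) ∧ A = f ⁻¹' {0}

mutual
/-- The `α`'th functionally additive class in `X`. -/
inductive FunAdd (X : Type u) [TopologicalSpace X] : Ordinal.{0} → Set X → Prop where
  | base (A : Set X) : FunctionallyOpen X A → FunAdd X 0 A
  | union (α : Ordinal.{0}) (hα : α ≠ 0) (β : ℕ → Ordinal.{0}) (hβ : ∀ n, β n < α)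
      (s : ℕ → Set X) (hs : ∀ n, FunMul X (β n) (s n)) : FunAdd X α (⋃ n, s n)

/-- The `α`'th functionally multiplicative class in `X`. -/
inductive FunMul (X : Type u) [TopologicalSpace X] : Ordinal.{0} → Set X → Prop where
  | base (A : Set X) : FunctionallyClosed X A → FunMul X 0 A
  | inter (α : Ordinal.{0}) (hα : α ≠ 0) (β : ℕ → Ordinal.{0}) (hβ : ∀ n, β n < α)
      (s : ℕ → Set X) (hs : ∀ n, FunAdd X (β n) (s n)) : FunMul X α (⋂ n, s n)
end

mutual
/-- The `α`'th (ordinary) additive Borel class in `X`. -/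
inductive BorelAdd (X : Type u) [TopologicalSpace X] : Ordinal.{0} → Set X → Prop where
  | base (A : Set X) : IsOpen A → BorelAdd X 0 A
  | union (α : Ordinal.{0}) (hα : α ≠ 0) (β : ℕ → Ordinal.{0}) (hβ : ∀ n, β n < α)
      (s : ℕ → Set X) (hs : ∀ n, BorelMul X (β n) (s n)) : BorelAdd X α (⋃ n, s n)

/-- The `α`'th (ordinary) multiplicative Borel class in `X`. -/
inductive BorelMul (X : Type u) [TopologicalSpace X] : Ordinal.{0} → Set X → Prop where
  | base (A : Set X) : IsClosed A → BorelMul X 0 A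
  | inter (α : Ordinal.{0}) (hα : α ≠ 0) (β : ℕ → Ordinal.{0}) (hβ : ∀ n, β n < α)
      (s : ℕ → Set X) (hs : ∀ n, BorelAdd X (β n) (s n)) : BorelMul X α (⋂ n, s n)
end

/-- A set is functionally ambiguous of class `α` if it belongs to both the `α`'th functionally
additive and the `α`'th functionally multiplicative class. -/
def FunAmbiguous (X : Type u) [TopologicalSpace X] (α : Ordinal.{0}) (A : Set X) : Prop :=
  FunAdd X α A ∧ FunMul X α A

/-- `f ∈ K_α(X,Y)`: for `α = 0` continuity, for `α > 0` preimages of open sets belong to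
the `α`'th functionally additive class. -/
def KClass {X : Type u} {Y : Type v} [TopologicalSpace X] [TopologicalSpace Y]
    (α : Ordinal.{0}) (f : X → Y) : Prop :=
  (α = 0 → Continuous f) ∧ (α ≠ 0 → ∀ V : Set Y, IsOpen V → FunAdd X α (f ⁻¹' V))

/-- `A` and `B` are `α`-separated in `X`. -/
def AlphaSeparated {X : Type u} [TopologicalSpace X] (α : Ordinal.{0}) (A B : Set X) : Prop :=
  ∃ f : X → ℝ, KClass α f ∧ A ⊆ f ⁻¹' {0} ∧ B ⊆ f ⁻¹' {1}

/-- `X` is an `α`-separated space: any two disjoint sets of the `α`'th (ordinary)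
multiplicative class are `α`-separated. -/
def AlphaSeparatedSpace (X : Type u) [TopologicalSpace X] (α : Ordinal.{0}) : Prop :=
  ∀ A B : Set X, BorelMul X α A → BorelMul X α B → Disjoint A B → AlphaSeparated α A B

/-- `E` is `α`-embedded in `X`. -/
def AlphaEmbedded {X : Type u} [TopologicalSpace X] (α : Ordinal.{0}) (E : Set X) : Prop :=
  (∀ A : Set ↥E, FunAdd ↥E α A → ∃ B : Set X, FunAdd X α B ∧ Subtype.val '' A = B ∩ E) ∧
  (∀ A : Set ↥E, FunMul ↥E α A → ∃ B : Set X, FunMul X α B ∧ Subtype.val '' A = B ∩ E)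

/-- `E` is ambiguously `α`-embedded in `X`. -/
def AmbiguouslyEmbedded {X : Type u} [TopologicalSpace X] (α : Ordinal.{0}) (E : Set X) : Prop :=
  ∀ A : Set ↥E, FunAmbiguous ↥E α A →
    ∃ B : Set X, FunAmbiguous X α B ∧ Subtype.val '' A = B ∩ E

/-- The first uncountable ordinal. -/
noncomputable def omega1 : Ordinal.{0} := (Cardinal.aleph 1).ord

/-- `A` is an `F_σ`-set: a countable union of closed sets. -/
def IsFSigma {X : Type u} [TopologicalSpace X] (A : Set X) : Prop :=
  ∃ F : ℕ → Set X, (∀ n, IsClosed (F n)) ∧ A = ⋃ n, F n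

/-- A space has a countable π-base. -/
def CountablePiBase (Z : Type v) [TopologicalSpace Z] : Prop :=
  ∃ 𝒰 : Set (Set Z), 𝒰.Countable ∧ (∀ U ∈ 𝒰, IsOpen U ∧ U.Nonempty) ∧
    ∀ V : Set Z, IsOpen V → V.Nonempty → ∃ U ∈ 𝒰, U ⊆ V

namespace Sep7

variable {X : Type u} [TopologicalSpace X]

def IsZ (S : Set X) : Prop := ∃ f : X → ℝ, Continuous f ∧ S = f ⁻¹' {0}

def Zs (S : Set X) : Prop := ∃ z : ℕ → Set X, (∀ n, IsZ (z n)) ∧ S = ⋃ n, z n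

lemma IsZ.fc {S : Set X} (h : IsZ S) : FunctionallyClosed X S := by
  obtain ⟨f, hf, rfl⟩ := h
  refine ⟨fun x => min |f x| 1, by fun_prop, fun x => ⟨by positivity, min_le_right _ _⟩, ?_⟩
  ext x
  simp only [mem_preimage, mem_singleton_iff]
  constructor
  · intro h; simp [h]
  · intro h
    rcases min_choice |f x| 1 with h' | h' <;> rw [h'] at h
    · exact abs_eq_zero.1 h
    · norm_num at h

lemma IsZ.fo {S : Set X} (h : IsZ S) : FunctionallyOpen X Sᶜ := by
  obtain ⟨f, hf, hI, rfl⟩ := h.fc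
  refine ⟨f, hf, hI, ?_⟩
  ext x
  simp only [mem_compl_iff, mem_preimage, mem_singleton_iff, mem_Ioc]
  exact ⟨fun h => ⟨lt_of_le_of_ne (hI x).1 (Ne.symm h), (hI x).2⟩, fun h => h.1.ne'⟩

lemma IsZ.of_fo {S : Set X} (h : FunctionallyOpen X S) : IsZ Sᶜ := by
  obtain ⟨f, hf, hI, rfl⟩ := h
  refine ⟨f, hf, ?_⟩
  ext x
  have := hI x
  simp only [mem_compl_iff, mem_preimage, mem_singleton_iff, mem_Ioc, not_and, not_le]
  constructor
  · intro h
    by_contra h0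
    exact absurd (h (lt_of_le_of_ne this.1 (Ne.symm h0))) (not_lt.2 this.2)
  · intro h h'; rw [h] at h'; exact absurd h' (lt_irrefl _)

lemma IsZ.empty : IsZ (∅ : Set X) := ⟨fun _ => 1, continuous_const, by ext; simp⟩
lemma IsZ.univ : IsZ (univ : Set X) := ⟨fun _ => 0, continuous_const, by ext; simp⟩

lemma IsZ.isClosed {S : Set X} (h : IsZ S) : IsClosed S := by
  obtain ⟨f, hf, rfl⟩ := h
  exact isClosed_singleton.preimage hf

lemma IsZ.inter {S T : Set X} (hS : IsZ S) (hT : IsZ T) : IsZ (S ∩ T) := by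
  obtain ⟨f, hf, rfl⟩ := hS
  obtain ⟨g, hg, rfl⟩ := hT
  refine ⟨fun x => |f x| + |g x|, by fun_prop, ?_⟩
  ext x
  simp only [mem_inter_iff, mem_preimage, mem_singleton_iff]
  rw [add_eq_zero_iff_of_nonneg (abs_nonneg _) (abs_nonneg _), abs_eq_zero, abs_eq_zero]

lemma IsZ.iInter_nat {s : ℕ → Set X} (h : ∀ n, IsZ (s n)) : IsZ (⋂ n, s n) := by
  choose f hf hI hs using fun n => (h n).fc
  have hb : ∀ n x, ‖(1/2 : ℝ)^n * f n x‖ ≤ (1/2 : ℝ)^n := by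
    intro n x
    rw [Real.norm_of_nonneg (mul_nonneg (by positivity) (hI n x).1)]
    exact mul_le_of_le_one_right (by positivity) (hI n x).2
  have hsum : ∀ x, Summable fun n => (1/2 : ℝ)^n * f n x := fun x =>
    Summable.of_norm_bounded summable_geometric_two (fun n => hb n x)
  refine ⟨fun x => ∑' n, (1/2 : ℝ)^n * f n x, ?_, ?_⟩
  · exact continuous_tsum (fun n => by have := hf n; fun_prop) summable_geometric_two hb
  · ext x
    simp only [mem_iInter, mem_preimage, mem_singleton_iff]
    have hnn : ∀ n, 0 ≤ (1/2 : ℝ)^n * f n x := fun n => mul_nonneg (by positivity) (hI n x).1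
    constructor
    · intro h0
      have : ∀ n, f n x = 0 := fun n => by have := h0 n; rw [hs n] at this; exact this
      simp [this]
    · intro h0 n
      have h1 := (hasSum_zero_iff_of_nonneg hnn).1 (h0 ▸ (hsum x).hasSum)
      have h2 := congrFun h1 n
      rw [hs n]
      simpa using h2

lemma IsZ.iInter {ι : Type*} [Countable ι] {s : ι → Set X} (h : ∀ n, IsZ (s n)) :
    IsZ (⋂ n, s n) := by
  rcases isEmpty_or_nonempty ι with hι | hι
  · simpa using IsZ.univ
  · obtain ⟨e, he⟩ := exists_surjective_nat ι
    rw [← he.iInter_comp]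
    exact IsZ.iInter_nat fun n => h _

lemma IsZ.zs {S : Set X} (h : IsZ S) : Zs S := ⟨fun _ => S, fun _ => h, (iUnion_const S).symm⟩

lemma Zs.of_countable {ι : Type*} [Countable ι] {s : ι → Set X} (h : ∀ n, IsZ (s n)) :
    Zs (⋃ n, s n) := by
  rcases isEmpty_or_nonempty ι with hι | hι
  · simpa using IsZ.empty.zs
  · obtain ⟨e, he⟩ := exists_surjective_nat ι
    rw [← he.iUnion_comp]
    exact ⟨_, fun n => h _, rfl⟩

lemma Zs.iUnion {ι : Type*} [Countable ι] {s : ι → Set X} (h : ∀ n, Zs (s n)) :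
    Zs (⋃ n, s n) := by
  choose z hz hs using h
  have : (⋃ n, s n) = ⋃ p : ι × ℕ, z p.1 p.2 := by
    rw [iUnion_prod']
    exact iUnion_congr hs
  rw [this]
  exact Zs.of_countable fun p => hz _ _

lemma Zs.union {S T : Set X} (hS : Zs S) (hT : Zs T) : Zs (S ∪ T) := by
  rw [union_eq_iUnion]
  exact Zs.iUnion fun b => by cases b <;> assumption

lemma Zs.inter {S T : Set X} (hS : Zs S) (hT : Zs T) : Zs (S ∩ T) := by
  obtain ⟨z, hz, rfl⟩ := hS
  obtain ⟨w, hw, rfl⟩ := hT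
  have : ((⋃ n, z n) ∩ ⋃ n, w n) = ⋃ p : ℕ × ℕ, z p.1 ∩ w p.2 := by
    ext x; simp
  rw [this]
  exact Zs.of_countable fun p => (hz _).inter (hw _)

/-- pieces of a cozero set -/
lemma IsZ.pieces (f : X → ℝ) (hf : Continuous f) (n : ℕ) : IsZ {x | 1 / ((n:ℝ) + 1) ≤ |f x|} := by
  refine ⟨fun x => max (1 / ((n:ℝ) + 1) - |f x|) 0, by fun_prop, ?_⟩
  ext x
  simp [max_eq_right_iff]

lemma pieces_iff (f : X → ℝ) (x : X) : f x ≠ 0 ↔ ∃ n : ℕ, 1 / ((n:ℝ) + 1) < |f x| := by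
  constructor
  · intro h; exact exists_nat_one_div_lt (abs_pos.2 h)
  · rintro ⟨n, hn⟩
    exact abs_pos.1 (lt_trans (by positivity) hn)

lemma IsZ.compl {S : Set X} (h : IsZ S) : Zs Sᶜ := by
  obtain ⟨f, hf, rfl⟩ := h
  refine ⟨fun n => {x | 1 / ((n:ℝ) + 1) ≤ |f x|}, fun n => IsZ.pieces f hf n, ?_⟩
  ext x
  simp only [mem_compl_iff, mem_preimage, mem_singleton_iff, mem_iUnion, mem_ofPred_eq]
  constructor
  · intro h
    obtain ⟨n, hn⟩ := (pieces_iff f x).1 h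
    exact ⟨n, hn.le⟩
  · rintro ⟨n, hn⟩ h0
    rw [h0, abs_zero] at hn
    exact absurd hn (not_le.2 (by positivity))

lemma Zs.funAdd {S : Set X} (h : Zs S) {α : Ordinal.{0}} (hα : α ≠ 0) : FunAdd X α S := by
  obtain ⟨z, hz, rfl⟩ := h
  exact FunAdd.union α hα (fun _ => 0) (fun _ => pos_iff_ne_zero.2 hα) z
    fun n => FunMul.base _ (hz n).fc

lemma Zs.funMul_one {S : Set X} (h : Zs Sᶜ) : FunMul X 1 S := by
  obtain ⟨z, hz, h⟩ := h
  have : S = ⋂ n, (z n)ᶜ := by rw [← compl_iUnion, ← h, compl_compl]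
  rw [this]
  exact FunMul.inter 1 one_ne_zero (fun _ => 0) (fun _ => zero_lt_one) _
    fun n => FunAdd.base _ (hz n).fo

lemma funMul_aux {α : Ordinal.{0}} {S : Set X} (h : FunMul X α S) (hα : α = 1) : Zs Sᶜ := by
  cases h with
  | base _ _ => exact absurd hα zero_ne_one
  | inter _ _ β hβ s hs =>
    subst hα
    rw [compl_iInter]
    refine ⟨_, fun n => ?_, rfl⟩
    have h0 : β n = 0 := Order.lt_one_iff.1 (hβ n)
    have := hs n
    generalize s n = T at *
    generalize β n = γ at *
    cases this with
    | base _ h => exact IsZ.of_fo h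
    | union _ hα => exact absurd h0 hα

lemma sep_of {α : Ordinal.{0}} (hα : α ≠ 0) {A B C : Set X} (h1 : FunAdd X α C)
    (h2 : FunAdd X α Cᶜ) (hA : A ⊆ C) (hB : Disjoint C B) : AlphaSeparated α A B := by
  classical
  refine ⟨Cᶜ.indicator (fun _ => 1), ⟨fun h => absurd h hα, fun _ V _ => ?_⟩, ?_, ?_⟩
  · have := Set.indicator_const_preimage (Cᶜ) V (1:ℝ)
    simp only [mem_insert_iff, mem_singleton_iff, compl_compl] at this
    rcases this with h | h | h | h <;> rw [h]
    · exact IsZ.univ.zs.funAdd hα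
    · exact h2
    · exact h1
    · exact IsZ.empty.zs.funAdd hα
  · intro x hx; simp [hA hx]
  · intro x hx
    have : x ∉ C := fun h => disjoint_left.1 hB h hx
    simp [this]

lemma reduction {A B : Set X} (hA : Zs Aᶜ) (hB : Zs Bᶜ) (hAB : Disjoint A B) :
    AlphaSeparated 1 A B := by
  obtain ⟨z, hz, hzA⟩ := hA
  obtain ⟨w, hw, hwB⟩ := hB
  have mA : ∀ x, x ∉ A ↔ ∃ n, x ∈ z n := fun x => by rw [← mem_compl_iff, hzA, mem_iUnion]
  have mB : ∀ x, x ∉ B ↔ ∃ n, x ∈ w n := fun x => by rw [← mem_compl_iff, hwB, mem_iUnion]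
  have key : ∀ (v : ℕ → Set X), (∀ n, IsZ (v n)) → ∀ t : Set ℕ, t.Finite →
      Zs (⋂ k ∈ t, (v k)ᶜ) := by
    intro v hv t ht
    induction t, ht using Set.Finite.induction_on with
    | empty => simpa using IsZ.univ.zs
    | insert _ _ ih => rw [biInter_insert]; exact (hv _).compl.inter ih
  let C : Set X := ⋃ n, w n ∩ ⋂ k ∈ Iio n, (z k)ᶜ
  have hC : Zs C := Zs.iUnion fun n => (hw n).zs.inter (key z hz _ (finite_Iio n))
  have hCc : Cᶜ = ⋃ n, z n ∩ ⋂ k ∈ Iic n, (w k)ᶜ := by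
    classical
    ext x
    simp only [C, mem_compl_iff, mem_iUnion, mem_inter_iff, mem_iInter, mem_Iio, mem_Iic, not_exists,
      not_and, not_forall, not_not]
    constructor
    · intro h
      have hz' : ∃ n, x ∈ z n := by
        by_contra hx
        have hxA : x ∈ A := by by_contra h'; exact hx ((mA x).1 h')
        obtain ⟨n, hn⟩ := (mB x).1 (disjoint_left.1 hAB hxA)
        obtain ⟨k, _, hk⟩ := h n hn
        exact hx ⟨k, hk⟩
      refine ⟨Nat.find hz', Nat.find_spec hz', fun k hk hkw => ?_⟩
      obtain ⟨j, hj, hjz⟩ := h k hkw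
      exact Nat.find_min hz' (lt_of_lt_of_le hj hk) hjz
    · rintro ⟨n, hn, hnw⟩ m hm
      refine ⟨n, ?_, hn⟩
      by_contra hlt
      exact hnw m (not_lt.1 hlt) hm
  have hCc' : Zs Cᶜ := by
    rw [hCc]
    exact Zs.iUnion fun n => (hz n).zs.inter (key w hw _ (finite_Iic n))
  refine sep_of one_ne_zero (hC.funAdd one_ne_zero) (hCc'.funAdd one_ne_zero) ?_ ?_
  · intro x hx
    obtain ⟨n, hn⟩ := (mB x).1 (disjoint_left.1 hAB hx)
    refine mem_iUnion.2 ⟨n, hn, mem_iInter₂.2 fun k _ hk => (mA x).2 ⟨k, hk⟩ hx⟩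
  · rw [disjoint_left]
    intro x hx hxB
    obtain ⟨n, hn, -⟩ := mem_iUnion.1 hx
    exact (mB x).2 ⟨n, hn⟩ hxB

/-- local structure of completely regular spaces -/
lemma local_coz [CompletelyRegularSpace X] {U : Set X} (hU : IsOpen U) {x : X} (hx : x ∈ U) :
    ∃ W Z : Set X, IsZ Wᶜ ∧ IsZ Z ∧ x ∈ W ∧ W ⊆ Z ∧ Z ⊆ U := by
  obtain ⟨f, hf, h0, h1⟩ := CompletelyRegularSpace.completely_regular x Uᶜ hU.isClosed_compl
    (by simpa using hx)
  have hg : Continuous fun y => (f y : ℝ) := by fun_prop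
  refine ⟨{y | (f y : ℝ) < 1/2}, {y | (f y : ℝ) ≤ 1/2}, ?_, ?_, ?_, ?_, ?_⟩
  · refine ⟨fun y => max (1/2 - (f y : ℝ)) 0, by fun_prop, ?_⟩
    ext y; simp
  · refine ⟨fun y => max ((f y : ℝ) - 1/2) 0, by fun_prop, ?_⟩
    ext y; simp
  · simp [h0]
  · intro y hy; exact le_of_lt (show (f y : ℝ) < 1/2 from hy)
  · intro y hy
    replace hy : (f y : ℝ) ≤ 1/2 := hy
    by_contra hyU
    have := h1 hyU
    rw [this] at hy
    norm_num at hy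

lemma lin_coz [CompletelyRegularSpace X] {S U : Set X} (hS : IsLindelof S) (hU : IsOpen U)
    (hSU : S ⊆ U) : ∃ W, IsZ Wᶜ ∧ S ⊆ W ∧ W ⊆ U := by
  choose! W Z hW hZ hx hWZ hZU using fun x (hx : x ∈ S) => local_coz hU (hSU hx)
  obtain ⟨t, htc, hts, ht⟩ := hS.elim_nhds_subcover W fun x hxS =>
    (isClosed_compl_iff.1 (hW x hxS).isClosed).mem_nhds (hx x hxS)
  have := htc.to_subtype
  refine ⟨⋃ x : t, W x, ?_, ?_, ?_⟩
  · rw [compl_iUnion]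
    exact IsZ.iInter fun x => hW _ (hts _ x.2)
  · rwa [← biUnion_eq_iUnion (t := fun x _ => W x)]
  · exact iUnion_subset fun x => (hWZ _ (hts _ x.2)).trans (hZU _ (hts _ x.2))

def Gs (S B : Set X) : Prop := ∃ G, Zs Gᶜ ∧ S ⊆ G ∧ Disjoint G B

lemma Gs.mono {S T B : Set X} (h : Gs T B) (hST : S ⊆ T) : Gs S B := by
  obtain ⟨G, h1, h2, h3⟩ := h
  exact ⟨G, h1, hST.trans h2, h3⟩

lemma Gs.combine {ι : Type*} [Countable ι] {S B : Set X} (W : ι → Set X) (hW : ∀ i, IsZ (W i)ᶜ)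
    (hS : S ⊆ ⋃ i, W i) (h : ∀ i, Gs (S ∩ W i) B) : Gs S B := by
  choose G hG hSG hGB using h
  refine ⟨(⋃ i, W i) \ ⋃ i, (W i \ G i), ?_, ?_, ?_⟩
  · have : ((⋃ i, W i) \ ⋃ i, (W i \ G i))ᶜ = (⋂ i, (W i)ᶜ) ∪ ⋃ i, (W i ∩ (G i)ᶜ) := by
      rw [diff_eq, compl_inter, compl_compl, compl_iUnion]; rfl
    rw [this]
    refine (IsZ.iInter hW).zs.union (Zs.iUnion fun i => Zs.inter ?_ (hG i))
    simpa using (hW i).compl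
  · intro x hx
    refine ⟨hS hx, ?_⟩
    simp only [mem_iUnion, mem_diff, not_exists, not_and, not_not]
    exact fun i hi => hSG i ⟨hx, hi⟩
  · rw [disjoint_left]
    rintro x ⟨hx, hx'⟩ hxB
    obtain ⟨i, hi⟩ := mem_iUnion.1 hx
    simp only [mem_iUnion, mem_diff, not_exists, not_and, not_not] at hx'
    exact disjoint_left.1 (hGB i) (hx' i hi) hxB

lemma Gs.lin {S B : Set X} (hS : IsLindelof S)
    (h : ∀ x ∈ S, ∃ W, x ∈ W ∧ IsZ Wᶜ ∧ Gs (S ∩ W) B) : Gs S B := by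
  choose! W hx hW hG using h
  obtain ⟨t, htc, hts, ht⟩ := hS.elim_nhds_subcover W fun x hxS =>
    (isClosed_compl_iff.1 (hW x hxS).isClosed).mem_nhds (hx x hxS)
  have := htc.to_subtype
  refine Gs.combine (fun x : t => W x) (fun x => hW _ (hts _ x.2)) ?_ fun x => hG _ (hts _ x.2)
  rwa [← biUnion_eq_iUnion (t := fun x _ => W x)]

lemma gs_b [CompletelyRegularSpace X] {A B : Set X} (hAB : Disjoint A B) (hA : IsLindelof A)
    (hH : ∀ C : Set ↥A, IsClosed C → BaireSpace ↥C) (hB : Zs Bᶜ) : Gs A B := by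
  obtain ⟨z, hz, hzB⟩ := hB
  let P : Set X → Prop := fun U => IsOpen U ∧ ∀ H, IsClosed H → H ∩ A ⊆ U → Gs (H ∩ A) B
  let M : Set X := ⋃₀ {U | P U}
  have hMo : IsOpen M := isOpen_sUnion fun U hU => hU.1
  have hM : ∀ H, IsClosed H → H ∩ A ⊆ M → Gs (H ∩ A) B := by
    intro H hHc hHM
    refine Gs.lin (hA.inter_left hHc) fun x hx => ?_
    obtain ⟨U, hU, hxU⟩ := hHM hx
    obtain ⟨W, Z, hW, hZ, hxW, hWZ, hZU⟩ := local_coz hU.1 hxU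
    refine ⟨W, hxW, hW, (hU.2 (H ∩ Z) (hHc.inter hZ.isClosed) ?_).mono ?_⟩
    · exact fun y hy => hZU hy.1.2
    · exact fun y hy => ⟨⟨hy.1.1, hWZ hy.2⟩, hy.1.2⟩
  by_cases hAM : A ⊆ M
  · simpa using hM univ isClosed_univ (by simpa using hAM)
  exfalso
  obtain ⟨a, haA, haM⟩ := not_subset.1 hAM
  let C : Set A := Subtype.val ⁻¹' Mᶜ
  have := hH C (hMo.isClosed_compl.preimage continuous_subtype_val)
  have : Nonempty C := ⟨⟨⟨a, haA⟩, haM⟩⟩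
  have hc : Continuous fun c : C => ((c : A) : X) := by fun_prop
  obtain ⟨n, c, hcn⟩ := nonempty_interior_of_iUnion_of_closed
    (f := fun n => (fun c : C => ((c : A) : X)) ⁻¹' z n)
    (fun n => (hz n).isClosed.preimage hc) (by
      rw [eq_univ_iff_forall]
      intro c
      have : ((c : A) : X) ∈ Bᶜ := disjoint_left.1 hAB c.1.2
      rw [hzB, mem_iUnion] at this
      obtain ⟨n, hn⟩ := this
      exact mem_iUnion.2 ⟨n, hn⟩)
  have hind : Topology.IsInducing fun c : C => ((c : A) : X) :=
    Topology.IsInducing.subtypeVal.comp Topology.IsInducing.subtypeVal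
  obtain ⟨V, hV, hVeq⟩ := hind.isOpen_iff.1 (isOpen_interior (s := (fun c : C => ((c : A) : X)) ⁻¹' z n))
  have hVz : ∀ y ∈ A, y ∈ V → y ∉ M → y ∈ z n := by
    intro y hyA hyV hyM
    have : (⟨⟨y, hyA⟩, hyM⟩ : C) ∈ interior ((fun c : C => ((c : A) : X)) ⁻¹' z n) := by
      rw [← hVeq]; exact hyV
    have h2 := interior_subset this
    exact h2
  have hcV : ((c : A) : X) ∈ V := by rw [← hVeq] at hcn; exact hcn
  have hznB : Disjoint (z n) B := by
    rw [disjoint_left]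
    intro x hx hxB
    have : x ∈ Bᶜ := by rw [hzB]; exact mem_iUnion.2 ⟨n, hx⟩
    exact this hxB
  have hP : P (M ∪ V) := by
    refine ⟨hMo.union hV, fun H hHc hHU => ?_⟩
    obtain ⟨f, hf, hfz⟩ := hz n
    have h1 : Gs ((H ∩ A) \ z n) B := by
      refine Gs.combine (fun k : ℕ => {x | 1 / ((k:ℝ) + 1) < |f x|}) ?_ ?_ ?_
      · intro k
        refine ⟨fun x => max (|f x| - 1 / ((k:ℝ) + 1)) 0, by fun_prop, ?_⟩
        ext x
        simp
      · rintro x ⟨_, hx⟩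
        rw [hfz] at hx
        exact mem_iUnion.2 ((pieces_iff f x).1 hx)
      · intro k
        refine (hM (H ∩ {x | 1 / ((k:ℝ) + 1) ≤ |f x|})
          (hHc.inter (IsZ.pieces f hf k).isClosed) ?_).mono ?_
        · rintro x ⟨⟨hxH, hxk⟩, hxA⟩
          rcases hHU ⟨hxH, hxA⟩ with h | h
          · exact h
          · by_contra hxM
            have := hVz x hxA h hxM
            rw [hfz] at this
            have h0 : f x = 0 := this
            have hxk : 1 / ((k:ℝ) + 1) ≤ |f x| := hxk
            rw [h0, abs_zero] at hxk
            exact absurd hxk (not_le.2 (by positivity))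
        · rintro x ⟨⟨hx, _⟩, hxk⟩
          have hxk' : 1 / ((k:ℝ) + 1) < |f x| := hxk
          have hxk2 : x ∈ {x | 1 / ((k:ℝ) + 1) ≤ |f x|} := hxk'.le
          exact ⟨⟨hx.1, hxk2⟩, hx.2⟩
    obtain ⟨G, hG, hHG, hGB⟩ := h1
    refine ⟨z n ∪ G, ?_, ?_, hznB.union_left hGB⟩
    · rw [compl_union]
      exact (hz n).compl.inter hG
    · intro x hx
      by_cases h : x ∈ z n
      · exact Or.inl h
      · exact Or.inr (hHG ⟨hx, h⟩)
  exact c.2 (mem_sUnion.2 ⟨M ∪ V, hP, Or.inr hcV⟩)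

lemma gdelta [CompletelyRegularSpace X] {A : Set X} (hA : IsLindelof A) (hG : IsGδ A) :
    Zs Aᶜ := by
  obtain ⟨U, hU, hAU⟩ := isGδ_iff_eq_iInter_nat.1 hG
  choose W hW hAW hWU using fun n => lin_coz hA (hU n) (hAU ▸ iInter_subset U n)
  have : A = ⋂ n, W n := by
    apply Subset.antisymm (subset_iInter hAW)
    conv_rhs => rw [hAU]
    exact iInter_mono hWU
  rw [this, compl_iInter]
  exact ⟨_, hW, rfl⟩

end Sep7

/-- separation of disjoint sets in a completely regular space. -/
theorem stmt7 {X : Type u} [TopologicalSpace X] [CompletelyRegularSpace X]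
    (A B : Set X) (hAB : Disjoint A B) :
    (IsLindelof A → IsGδ A → IsLindelof B → IsGδ B → AlphaSeparated 1 A B) ∧
    (IsLindelof A → (∀ C : Set ↥A, IsClosed C → BaireSpace ↥C) → FunMul X 1 B →
      AlphaSeparated 1 A B) ∧
    (IsLindelof A → IsFSigma B → AlphaSeparated 2 A B) := by
  refine ⟨fun hA hA' hB hB' => ?_, fun hA hH hB => ?_, fun hA hB => ?_⟩
  · exact Sep7.reduction (Sep7.gdelta hA hA') (Sep7.gdelta hB hB') hAB
  · have hB' := Sep7.funMul_aux hB rfl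
    obtain ⟨G, hG, hAG, hGB⟩ := Sep7.gs_b hAB hA hH hB'
    obtain ⟨f, hf, h0, h1⟩ := Sep7.reduction hG hB' hGB
    exact ⟨f, hf, hAG.trans h0, h1⟩
  · obtain ⟨F, hF, rfl⟩ := hB
    choose W hW hAW hWF using fun n => Sep7.lin_coz hA (hF n).isOpen_compl
      (fun x hx hxF => disjoint_left.1 hAB hx (mem_iUnion.2 ⟨n, hxF⟩))
    have hc : Sep7.Zs (⋂ n, W n)ᶜ := by
      rw [compl_iInter]
      exact ⟨_, hW, rfl⟩
    have h2 : (2 : Ordinal.{0}) ≠ 0 := two_ne_zero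
    refine Sep7.sep_of (C := ⋂ n, W n) h2 ?_ (hc.funAdd h2) (subset_iInter hAW) ?_
    · have := FunAdd.union (X := X) 2 h2 (fun _ => 1) (fun _ => one_lt_two) (fun _ => ⋂ n, W n)
        (fun _ => hc.funMul_one)
      rwa [iUnion_const] at this
    · rw [disjoint_left]
      intro x hx hxF
      obtain ⟨n, hn⟩ := mem_iUnion.1 hxF
      exact hWF n (mem_iInter.1 hx n) hn
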